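/- arXiv:2407.05451 — 4 statements merged into one kernel-verified Lean document; each statement's English description precedes it below -/
import Mathlib

section
/- Every feasible point of the 2BB-2F model is dominated by a feasible point of the 1BB-1F model: if (f_bt_cp, f_pv_cp, f_cp_bt, f_cp_ed, f_ed_cp, s) is 2BB-2F feasible, then there exists a 1BB-1F feasible point (f'_bt_ed, f'_pv_bt, f'_pv_ed, s') such that for every t, the total PV output satisfies f'_pv_bt(t) + f'_pv_ed(t) ≤ f_pv_cp(t) and the battery discharge satisfies f'_bt_ed(t) ≤ f_bt_cp(t). Consequently, for any nonnegative unit costs C_pv, C_bt, the 1BB-1F point has cost Σ_t [C_pv·(f'_pv_bt(t)+f'_pv_ed(t)) + C_bt·f'_bt_ed(t)] no larger than the 2BB-2F cost Σ_t [C_pv·f_pv_cp(t) + C_bt·f_bt_cp(t)]. -/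
open Finset

/-- Storage level at the end of the previous period (`S0` for the first period). -/
def sprev (T : ℕ) (S0 : ℝ) (s : Fin T → ℝ) (t : Fin T) : ℝ :=
  if (t : ℕ) = 0 then S0
  else s ⟨(t : ℕ) - 1, Nat.lt_of_le_of_lt (Nat.sub_le _ _) t.isLt⟩

/-- 1BB-1F feasible set. -/
def Feas1BB (T : ℕ) (Pbt Sbt S0 etain etaout : ℝ) (Ppv D : Fin T → ℝ)
    (fbted fpvbt fpved s : Fin T → ℝ) : Prop :=
  ∀ t : Fin T,
    0 ≤ fbted t ∧ 0 ≤ fpvbt t ∧ 0 ≤ fpved t ∧ 0 ≤ s t ∧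
    fbted t + fpved t = D t ∧
    s t = sprev T S0 s t + etain * fpvbt t - (1 / etaout) * fbted t ∧
    fbted t ≤ Pbt ∧ fpvbt t ≤ Pbt ∧ fpvbt t + fpved t ≤ Ppv t ∧ s t ≤ Sbt

/-- 2BB-2F feasible set (grid-to-battery charging forbidden). -/
def Feas2BB2F (T : ℕ) (Pbt Sbt S0 etain etaout : ℝ) (Ppv D : Fin T → ℝ)
    (fbtcp fpvcp fcpbt fcped fedcp s : Fin T → ℝ) : Prop :=
  ∀ t : Fin T,
    0 ≤ fbtcp t ∧ 0 ≤ fpvcp t ∧ 0 ≤ fcpbt t ∧ 0 ≤ fcped t ∧ 0 ≤ fedcp t ∧ 0 ≤ s t ∧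
    fbtcp t + fpvcp t + fedcp t = fcpbt t + fcped t ∧
    fcped t = D t + fedcp t ∧
    s t = sprev T S0 s t + etain * fcpbt t - (1 / etaout) * fbtcp t ∧
    fbtcp t ≤ Pbt ∧ fcpbt t ≤ Pbt ∧ fpvcp t ≤ Ppv t ∧ fedcp t = 0 ∧
    fcped t ≤ Pbt + Ppv t ∧ s t ≤ Sbt

/-- PV-to-battery flow obtained by netting a discharge `b` against a charge `c` at storage level
`u`, curtailed so that the storage capacity `Sbt` is not exceeded. -/
noncomputable def netCharge (Sbt etain b c u : ℝ) : ℝ :=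
  min (max (c - b) 0) ((Sbt - u) / etain)

/-- Storage level after one period of netted flows, starting from the level `u`. -/
noncomputable def netStep (Sbt etain etaout b c u : ℝ) : ℝ :=
  u + etain * netCharge Sbt etain b c u - (1 / etaout) * max (b - c) 0

/-- Storage trajectory of the netted flows. -/
noncomputable def netStorage (Sbt S0 etain etaout : ℝ) (b c : ℕ → ℝ) : ℕ → ℝ
  | 0 => S0
  | n + 1 => netStep Sbt etain etaout (b n) (c n) (netStorage Sbt S0 etain etaout b c n)

lemma netCharge_nonneg {Sbt etain b c u : ℝ} (hin : 0 < etain) (hu : u ≤ Sbt) :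
    0 ≤ netCharge Sbt etain b c u :=
  le_min (le_max_right _ _) (div_nonneg (sub_nonneg.2 hu) hin.le)

lemma netCharge_le_max {Sbt etain b c u : ℝ} :
    netCharge Sbt etain b c u ≤ max (c - b) 0 :=
  min_le_left _ _

lemma netStep_le {Sbt etain etaout b c u : ℝ} (hin : 0 < etain) (hout : 0 < etaout) :
    netStep Sbt etain etaout b c u ≤ Sbt := by
  have hx : netCharge Sbt etain b c u ≤ (Sbt - u) / etain := min_le_right _ _
  rw [le_div_iff₀ hin] at hx
  have hd : 0 ≤ (1 / etaout) * max (b - c) 0 := by positivity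
  unfold netStep
  linarith

/-- Netting never lowers the storage level below the original trajectory. -/
lemma le_netStep {Sbt etain etaout b c u v : ℝ} (hin : 0 < etain) (hin1 : etain ≤ 1)
    (hout : 0 < etaout) (hout1 : etaout ≤ 1) (hb : 0 ≤ b) (hc : 0 ≤ c)
    (hvu : v ≤ u) (hu : u ≤ Sbt) (hv : v + etain * c - (1 / etaout) * b ≤ Sbt) :
    v + etain * c - (1 / etaout) * b ≤ netStep Sbt etain etaout b c u := by
  have hk : 1 ≤ 1 / etaout := (one_le_div hout).2 hout1
  unfold netStep netCharge
  rcases le_total c b with h | h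
  · rw [max_eq_right (sub_nonpos.2 h), max_eq_left (sub_nonneg.2 h),
      min_eq_left (div_nonneg (sub_nonneg.2 hu) hin.le)]
    nlinarith [mul_nonneg (sub_nonneg.2 (hin1.trans hk)) hc]
  · rw [max_eq_left (sub_nonneg.2 h), max_eq_right (sub_nonpos.2 h)]
    rcases min_choice (c - b) ((Sbt - u) / etain) with h' | h' <;> rw [h']
    · nlinarith [mul_nonneg (sub_nonneg.2 (hin1.trans hk)) hb]
    · rw [mul_div_cancel₀ _ hin.ne']
      linarith

lemma netStorage_le {Sbt S0 etain etaout : ℝ} {b c : ℕ → ℝ} (hin : 0 < etain)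
    (hout : 0 < etaout) (hS0 : S0 ≤ Sbt) (n : ℕ) :
    netStorage Sbt S0 etain etaout b c n ≤ Sbt := by
  cases n with
  | zero => exact hS0
  | succ n => exact netStep_le hin hout

/-- A trajectory read off from a sequence that starts at `S0` has the expected previous level. -/
lemma sprev_succ {T : ℕ} {S0 : ℝ} {u : ℕ → ℝ} (hu : u 0 = S0) (t : Fin T) :
    sprev T S0 (fun i : Fin T => u (i + 1)) t = u t := by
  unfold sprev
  split_ifs with h
  · rw [h, hu]
  · exact congrArg u (Nat.sub_add_cancel (Nat.pos_of_ne_zero h))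

/-- every 2BB-2F feasible point is dominated by a 1BB-1F feasible point. -/
theorem stmt1 (T : ℕ) (hT : 1 ≤ T) (Pbt Sbt S0 etain etaout : ℝ)
    (hPbt : 0 ≤ Pbt) (hSbt : 0 ≤ Sbt) (hS0 : 0 ≤ S0) (hS0' : S0 ≤ Sbt)
    (hin : 0 < etain) (hin1 : etain ≤ 1) (hout : 0 < etaout) (hout1 : etaout ≤ 1)
    (Ppv D : Fin T → ℝ) (hPpv : ∀ t, 0 ≤ Ppv t) (hD : ∀ t, 0 ≤ D t)
    (fbtcp fpvcp fcpbt fcped fedcp s : Fin T → ℝ)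
    (hfeas : Feas2BB2F T Pbt Sbt S0 etain etaout Ppv D fbtcp fpvcp fcpbt fcped fedcp s) :
    ∃ fbted' fpvbt' fpved' s' : Fin T → ℝ,
      Feas1BB T Pbt Sbt S0 etain etaout Ppv D fbted' fpvbt' fpved' s' ∧
      (∀ t : Fin T, fpvbt' t + fpved' t ≤ fpvcp t ∧ fbted' t ≤ fbtcp t) ∧
      ∀ Cpv Cbt : ℝ, 0 ≤ Cpv → 0 ≤ Cbt →
        ∑ t, (Cpv * (fpvbt' t + fpved' t) + Cbt * fbted' t)
          ≤ ∑ t, (Cpv * fpvcp t + Cbt * fbtcp t) := by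
  set b : ℕ → ℝ := fun n => if h : n < T then fbtcp ⟨n, h⟩ else 0 with hb
  set c : ℕ → ℝ := fun n => if h : n < T then fcpbt ⟨n, h⟩ else 0 with hc
  have hbt (t : Fin T) : b t = fbtcp t := by simp [hb]
  have hct (t : Fin T) : c t = fcpbt t := by simp [hc]
  set u := netStorage Sbt S0 etain etaout b c with hu
  have hu_le (n : ℕ) : u n ≤ Sbt := netStorage_le hin hout hS0' n
  have hu_succ (t : Fin T) :
      u (t + 1) = netStep Sbt etain etaout (fbtcp t) (fcpbt t) (u t) := by
    rw [← hbt, ← hct, hu, netStorage]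
  have step (t : Fin T) (h : sprev T S0 s t ≤ u t) : s t ≤ u (t + 1) := by
    obtain ⟨h1, -, h3, -, -, -, -, -, h9, -, -, -, -, -, h15⟩ := hfeas t
    rw [hu_succ, h9]
    exact le_netStep hin hin1 hout hout1 h1 h3 h (hu_le _) (h9 ▸ h15)
  have hs_le (n : ℕ) (hn : n < T) : s ⟨n, hn⟩ ≤ u (n + 1) := by
    induction n with
    | zero => exact step ⟨0, hn⟩ (by simp [sprev, hu, netStorage])
    | succ n ih => exact step ⟨n + 1, hn⟩ (by simpa [sprev] using ih (by omega))
  have hdom (t : Fin T) :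
      netCharge Sbt etain (fbtcp t) (fcpbt t) (u t) + (D t - max (fbtcp t - fcpbt t) 0)
        ≤ fpvcp t ∧ max (fbtcp t - fcpbt t) 0 ≤ fbtcp t := by
    obtain ⟨h1, -, h3, -, -, -, h7, h8, -⟩ := hfeas t
    have hx : netCharge Sbt etain (fbtcp t) (fcpbt t) (u t) ≤ _ := netCharge_le_max
    have hmax := max_zero_sub_eq_self (fcpbt t - fbtcp t)
    rw [neg_sub] at hmax
    exact ⟨by linarith, max_le (by linarith) h1⟩
  refine ⟨fun t => max (fbtcp t - fcpbt t) 0,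
    fun t => netCharge Sbt etain (fbtcp t) (fcpbt t) (u t),
    fun t => D t - max (fbtcp t - fcpbt t) 0, fun t => u (t + 1), fun t => ?_, hdom, ?_⟩
  · obtain ⟨h1, h2, h3, -, -, h6, h7, h8, -, h10, h11, h12, -⟩ := hfeas t
    have hx : netCharge Sbt etain (fbtcp t) (fcpbt t) (u t) ≤ max (fcpbt t - fbtcp t) 0 :=
      netCharge_le_max
    obtain ⟨hpv, hdis⟩ := hdom t
    refine ⟨le_max_right _ _, netCharge_nonneg hin (hu_le _),
      sub_nonneg.2 (max_le (by linarith) (hD t)), h6.trans (hs_le t t.isLt), by ring, ?_,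
      hdis.trans h10, hx.trans (max_le (by linarith) hPbt), hpv.trans h12, hu_le _⟩
    rw [sprev_succ (by rw [hu, netStorage]) t]
    exact hu_succ t
  · intro Cpv Cbt hCpv hCbt
    refine Finset.sum_le_sum fun t _ => ?_
    obtain ⟨hpv, hdis⟩ := hdom t
    gcongr
end

section
/- The 1BB-1F and 2BB-2F formulations have the same optimal value: for any nonnegative unit costs C_pv, C_bt, the infimum over the 1BB-1F feasible set of the cost Σ_t [C_pv·(f_pv_bt(t)+f_pv_ed(t)) + C_bt·f_bt_ed(t)] equals the infimum over the 2BB-2F feasible set of the cost Σ_t [C_pv·f_pv_cp(t) + C_bt·f_bt_cp(t)], where both infima are taken in the extended nonnegative reals (with inf ∅ = ∞). In particular, one feasible set is nonempty if and only if the other is. -/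
open Finset

/-- Storage level when the net inflow `x` is curtailed so that the level never exceeds `Sbt`. -/
noncomputable def clippedLevel (Sbt S0 : ℝ) (x : ℕ → ℝ) : ℕ → ℝ
  | 0 => S0
  | n + 1 => min Sbt (clippedLevel Sbt S0 x n + x n)

theorem clippedLevel_le {Sbt S0 : ℝ} (h : S0 ≤ Sbt) (x : ℕ → ℝ) (n : ℕ) :
    clippedLevel Sbt S0 x n ≤ Sbt := by
  cases n with
  | zero => exact h
  | succ n => exact min_le_left _ _

theorem sprev_clippedLevel (T : ℕ) (Sbt S0 : ℝ) (x : ℕ → ℝ) (t : Fin T) :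
    sprev T S0 (fun u => clippedLevel Sbt S0 x (u + 1)) t = clippedLevel Sbt S0 x t := by
  obtain ⟨n, hn⟩ := t
  cases n <;> simp [sprev, clippedLevel]

/-- A storage trajectory bounded by `Sbt` whose increments are at most `x` stays below the
clipped level. -/
theorem sprev_le_clippedLevel {T : ℕ} {Sbt S0 : ℝ} {x : ℕ → ℝ} {s : Fin T → ℝ}
    (hs : ∀ t, s t ≤ Sbt) (hx : ∀ t : Fin T, s t ≤ sprev T S0 s t + x t) (t : Fin T) :
    sprev T S0 s t ≤ clippedLevel Sbt S0 x t := by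
  obtain ⟨n, hn⟩ := t
  induction n with
  | zero => simp [sprev, clippedLevel]
  | succ n ih =>
    have hn' : n < T := by omega
    have h := ih hn'
    have h2 := hx ⟨n, hn'⟩
    have h3 : sprev T S0 s ⟨n + 1, hn⟩ = s ⟨n, hn'⟩ := by simp [sprev]
    rw [h3]
    exact le_min (hs _) (by dsimp only at h h2 ⊢; linarith)

/-- Every 1BB-1F feasible point induces a 2BB-2F feasible point with the same storage levels. -/
theorem Feas1BB.toFeas2BB2F {T : ℕ} {Pbt Sbt S0 etain etaout : ℝ} {Ppv D : Fin T → ℝ}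
    {fbted fpvbt fpved s : Fin T → ℝ} (hD : ∀ t, 0 ≤ D t)
    (h : Feas1BB T Pbt Sbt S0 etain etaout Ppv D fbted fpvbt fpved s) :
    Feas2BB2F T Pbt Sbt S0 etain etaout Ppv D fbted (fun t => fpvbt t + fpved t) fpvbt D
      (fun _ => 0) s := by
  intro t
  obtain ⟨h1, h2, h3, h4, h5, h6, h7, h8, h9, h10⟩ := h t
  have := hD t
  refine ⟨h1, ?_, h2, this, le_rfl, h4, ?_, ?_, h6, h7, h8, h9, rfl, ?_, h10⟩ <;> linarith

/-- Every 2BB-2F feasible point is dominated, period by period in both cost drivers, by a 1BB-1F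
feasible point: battery-to-battery flow is cancelled, and charging that no longer fits is
curtailed. -/
theorem Feas2BB2F.exists_feas1BB {T : ℕ} {Pbt Sbt S0 etain etaout : ℝ} {Ppv D : Fin T → ℝ}
    {fbtcp fpvcp fcpbt fcped fedcp s : Fin T → ℝ} (hS0' : S0 ≤ Sbt)
    (hin : 0 < etain) (hin1 : etain ≤ 1) (hout : 0 < etaout) (hout1 : etaout ≤ 1)
    (hD : ∀ t, 0 ≤ D t)
    (h : Feas2BB2F T Pbt Sbt S0 etain etaout Ppv D fbtcp fpvcp fcpbt fcped fedcp s) :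
    ∃ fbted fpvbt fpved s' : Fin T → ℝ,
      Feas1BB T Pbt Sbt S0 etain etaout Ppv D fbted fpvbt fpved s' ∧
      ∀ t, fpvbt t + fpved t ≤ fpvcp t ∧ fbted t ≤ fbtcp t := by
  have hout' : 1 ≤ 1 / etaout := (one_le_div hout).2 hout1
  set k := 1 / etaout with hk
  let b : Fin T → ℝ := fun t => min (fbtcp t) (D t)
  let c : Fin T → ℝ := fun t => fcpbt t - (fbtcp t - b t)
  let x : ℕ → ℝ := fun n => if hn : n < T then etain * c ⟨n, hn⟩ - k * b ⟨n, hn⟩ else 0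
  have hxt : ∀ t : Fin T, x t = etain * c t - k * b t := fun t => by simp [x]
  have hb : ∀ t, b t ≤ fbtcp t := fun t => min_le_left _ _
  have hbD : ∀ t, b t ≤ D t := fun t => min_le_right _ _
  have hb0 : ∀ t, 0 ≤ b t := fun t => le_min (h t).1 (hD t)
  let L := clippedLevel Sbt S0 x
  have hLle : ∀ n, L n ≤ Sbt := clippedLevel_le hS0' x
  have hinc : ∀ t : Fin T, s t ≤ sprev T S0 s t + x t := by
    intro t
    obtain ⟨-, -, -, -, -, -, -, -, h9, -⟩ := h t
    rw [h9, hxt]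
    have : 0 ≤ (k - etain) * (fbtcp t - b t) :=
      mul_nonneg (by linarith) (sub_nonneg.2 (hb t))
    simp only [c]
    linarith
  have hsL : ∀ t : Fin T, s t ≤ L (t + 1) := fun t =>
    le_min (h t).2.2.2.2.2.2.2.2.2.2.2.2.2.2 <| (hinc t).trans <| by
      gcongr
      exact sprev_le_clippedLevel (fun t => (h t).2.2.2.2.2.2.2.2.2.2.2.2.2.2) hinc t
  let c' : Fin T → ℝ := fun t => (L (t + 1) - L t + k * b t) / etain
  have hc' : ∀ t, etain * c' t = L (t + 1) - L t + k * b t := fun t =>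
    mul_div_cancel₀ _ hin.ne'
  have hc'c : ∀ t, c' t ≤ c t := by
    intro t
    have hL : L (t + 1) ≤ L t + x t := min_le_right _ _
    rw [hxt] at hL
    exact (div_le_iff₀' hin).2 (by linarith)
  have hc0 : ∀ t, 0 ≤ c t := by
    intro t
    obtain ⟨-, h2, h3, -, -, -, h7, h8, -, -, -, -, h13, -⟩ := h t
    simp only [c, b]
    rcases min_choice (fbtcp t) (D t) with e | e <;> rw [e] <;> linarith
  have hc'0 : ∀ t, 0 ≤ c' t := by
    intro t
    refine div_nonneg ?_ hin.le
    have hkb : 0 ≤ k * b t := mul_nonneg (by linarith) (hb0 t)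
    have hec : 0 ≤ etain * c t := mul_nonneg hin.le (hc0 t)
    have hL : L t - k * b t ≤ L (t + 1) :=
      le_min (by linarith [hLle t]) (by rw [hxt]; change _ ≤ L t + _; linarith)
    linarith
  refine ⟨b, c', fun t => D t - b t, fun t => L (t + 1), fun t => ?_, fun t => ?_⟩
  · obtain ⟨-, h2, h3, -, -, h6, h7, h8, -, h10, h11, h12, h13, -⟩ := h t
    have hcc : c t = fcpbt t - (fbtcp t - b t) := rfl
    refine ⟨hb0 t, hc'0 t, sub_nonneg.2 (hbD t), h6.trans (hsL t), by ring, ?_,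
      (hb t).trans h10, ?_, ?_, hLle _⟩
    · rw [sprev_clippedLevel, hc']
      change _ = L t + _ - _
      ring
    · linarith [hc'c t, hb t]
    · linarith [hc'c t]
  · obtain ⟨-, -, -, -, -, -, h7, h8, -⟩ := h t
    have hcc : c t = fcpbt t - (fbtcp t - b t) := rfl
    exact ⟨by linarith [hc'c t], hb t⟩

/-- the 1BB-1F and 2BB-2F formulations have the same optimal value,
and one feasible set is nonempty iff the other is. -/
theorem stmt2 (T : ℕ) (hT : 1 ≤ T) (Pbt Sbt S0 etain etaout : ℝ)
    (hPbt : 0 ≤ Pbt) (hSbt : 0 ≤ Sbt) (hS0 : 0 ≤ S0) (hS0' : S0 ≤ Sbt)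
    (hin : 0 < etain) (hin1 : etain ≤ 1) (hout : 0 < etaout) (hout1 : etaout ≤ 1)
    (Ppv D : Fin T → ℝ) (hPpv : ∀ t, 0 ≤ Ppv t) (hD : ∀ t, 0 ≤ D t)
    (Cpv Cbt : ℝ) (hCpv : 0 ≤ Cpv) (hCbt : 0 ≤ Cbt) :
    (sInf {c : ENNReal | ∃ fbted fpvbt fpved s : Fin T → ℝ,
        Feas1BB T Pbt Sbt S0 etain etaout Ppv D fbted fpvbt fpved s ∧
        c = ENNReal.ofReal (∑ t, (Cpv * (fpvbt t + fpved t) + Cbt * fbted t))}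
      = sInf {c : ENNReal | ∃ fbtcp fpvcp fcpbt fcped fedcp s : Fin T → ℝ,
        Feas2BB2F T Pbt Sbt S0 etain etaout Ppv D fbtcp fpvcp fcpbt fcped fedcp s ∧
        c = ENNReal.ofReal (∑ t, (Cpv * fpvcp t + Cbt * fbtcp t))}) ∧
    ((∃ fbted fpvbt fpved s : Fin T → ℝ, Feas1BB T Pbt Sbt S0 etain etaout Ppv D fbted fpvbt fpved s) ↔
      (∃ fbtcp fpvcp fcpbt fcped fedcp s : Fin T → ℝ,
        Feas2BB2F T Pbt Sbt S0 etain etaout Ppv D fbtcp fpvcp fcpbt fcped fedcp s)) := by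
  refine ⟨le_antisymm ?_ ?_, ?_, ?_⟩
  · refine le_sInf ?_
    rintro _ ⟨fbtcp, fpvcp, fcpbt, fcped, fedcp, s, h, rfl⟩
    obtain ⟨fbted, fpvbt, fpved, s', h', hle⟩ := h.exists_feas1BB hS0' hin hin1 hout hout1 hD
    refine le_trans (sInf_le ⟨fbted, fpvbt, fpved, s', h', rfl⟩) ?_
    refine ENNReal.ofReal_le_ofReal (Finset.sum_le_sum fun t _ => ?_)
    exact add_le_add (mul_le_mul_of_nonneg_left (hle t).1 hCpv)
      (mul_le_mul_of_nonneg_left (hle t).2 hCbt)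
  · refine le_sInf ?_
    rintro _ ⟨fbted, fpvbt, fpved, s, h, rfl⟩
    exact sInf_le ⟨_, _, _, _, _, _, h.toFeas2BB2F hD, rfl⟩
  · rintro ⟨fbted, fpvbt, fpved, s, h⟩
    exact ⟨_, _, _, _, _, _, h.toFeas2BB2F hD⟩
  · rintro ⟨fbtcp, fpvcp, fcpbt, fcped, fedcp, s, h⟩
    obtain ⟨fbted, fpvbt, fpved, s', h', -⟩ := h.exists_feas1BB hS0' hin hin1 hout hout1 hD
    exact ⟨fbted, fpvbt, fpved, s', h'⟩
end

section
/- Every feasible point of the 2BB-1F model is dominated by a feasible point of the 1BB-1F model: if (f_bt_cp, f_pv_cp, f_cp_bt, f_cp_ed, s) is 2BB-1F feasible, then there exists a 1BB-1F feasible point (f'_bt_ed, f'_pv_bt, f'_pv_ed, s') such that for every t, f'_pv_bt(t) + f'_pv_ed(t) ≤ f_pv_cp(t) and f'_bt_ed(t) ≤ f_bt_cp(t); hence, for any nonnegative unit costs C_pv, C_bt, its cost Σ_t [C_pv·(f'_pv_bt(t)+f'_pv_ed(t)) + C_bt·f'_bt_ed(t)] does not exceed Σ_t [C_pv·f_pv_cp(t)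 + C_bt·f_bt_cp(t)]. -/
open Finset

/-- 2BB-1F feasible set. -/
def Feas2BB1F (T : ℕ) (Pbt Sbt S0 etain etaout : ℝ) (Ppv D : Fin T → ℝ)
    (fbtcp fpvcp fcpbt fcped s : Fin T → ℝ) : Prop :=
  ∀ t : Fin T,
    0 ≤ fbtcp t ∧ 0 ≤ fpvcp t ∧ 0 ≤ fcpbt t ∧ 0 ≤ fcped t ∧ 0 ≤ s t ∧
    fbtcp t + fpvcp t = fcpbt t + fcped t ∧
    fcped t = D t ∧
    s t = sprev T S0 s t + etain * fcpbt t - (1 / etaout) * fbtcp t ∧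
    fbtcp t ≤ Pbt ∧ fcpbt t ≤ Pbt ∧ fpvcp t ≤ Ppv t ∧
    fcped t ≤ Pbt + Ppv t ∧ s t ≤ Sbt

/-- Storage level after one period starting from level `x`, when simultaneous charging `c` and
discharging `b` are netted out and the charge is curtailed at the capacity `Sbt`. -/
noncomputable def nettedStep (Sbt etain etaout b c x : ℝ) : ℝ :=
  x + etain * min (max (c - b) 0) ((Sbt - x) / etain) - (1 / etaout) * max (b - c) 0

theorem nettedStep_le {Sbt etain etaout b c x : ℝ} (hin : 0 < etain) (hout : 0 < etaout) :
    nettedStep Sbt etain etaout b c x ≤ Sbt := by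
  have h1 : etain * min (max (c - b) 0) ((Sbt - x) / etain) ≤ etain * ((Sbt - x) / etain) :=
    mul_le_mul_of_nonneg_left (min_le_right _ _) hin.le
  rw [mul_div_cancel₀ _ hin.ne'] at h1
  have h2 : 0 ≤ (1 / etaout) * max (b - c) 0 := by positivity
  unfold nettedStep
  linarith

theorem le_nettedStep {Sbt etain etaout b c x y : ℝ} (hin : 0 < etain) (hin1 : etain ≤ 1)
    (hout : 0 < etaout) (hout1 : etaout ≤ 1) (hb : 0 ≤ b) (hc : 0 ≤ c)
    (hyx : y ≤ x) (hx : x ≤ Sbt) (hy : y + etain * c - (1 / etaout) * b ≤ Sbt) :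
    y + etain * c - (1 / etaout) * b ≤ nettedStep Sbt etain etaout b c x := by
  have hout' : 1 ≤ 1 / etaout := by rwa [le_div_iff₀ hout, one_mul]
  unfold nettedStep
  rcases le_total b c with h | h
  · rw [max_eq_left (sub_nonneg.2 h), max_eq_right (sub_nonpos.2 h)]
    rcases le_total (c - b) ((Sbt - x) / etain) with h' | h'
    · rw [min_eq_left h']
      nlinarith [mul_nonneg hb (sub_nonneg.2 (hin1.trans hout'))]
    · rw [min_eq_right h', mul_div_cancel₀ _ hin.ne']
      linarith
  · have h0 : 0 ≤ (Sbt - x) / etain := div_nonneg (sub_nonneg.2 hx) hin.le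
    rw [max_eq_right (sub_nonpos.2 h), max_eq_left (sub_nonneg.2 h), min_eq_left h0]
    nlinarith [mul_nonneg hc (sub_nonneg.2 (hin1.trans hout'))]

/-- Storage trajectory obtained by iterating `nettedStep`, indexed by the number of elapsed
periods. -/
noncomputable def nettedStorage (T : ℕ) (Sbt S0 etain etaout : ℝ) (b c : Fin T → ℝ) : ℕ → ℝ
  | 0 => S0
  | n + 1 =>
    if h : n < T then
      nettedStep Sbt etain etaout (b ⟨n, h⟩) (c ⟨n, h⟩)
        (nettedStorage T Sbt S0 etain etaout b c n)
    else nettedStorage T Sbt S0 etain etaout b c n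

theorem nettedStorage_succ (T : ℕ) (Sbt S0 etain etaout : ℝ) (b c : Fin T → ℝ) (t : Fin T) :
    nettedStorage T Sbt S0 etain etaout b c (t + 1) =
      nettedStep Sbt etain etaout (b t) (c t) (nettedStorage T Sbt S0 etain etaout b c t) := by
  simp [nettedStorage]

theorem sprev_comp_succ (T : ℕ) (u : ℕ → ℝ) (t : Fin T) :
    sprev T (u 0) (fun i => u (i + 1)) t = u t := by
  unfold sprev
  split_ifs with h
  · rw [h]
  · exact congrArg u (Nat.sub_add_cancel (Nat.pos_of_ne_zero h))

/-- The netted trajectory stays above every feasible trajectory with the same gross flows. -/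
theorem sprev_le_nettedStorage {T : ℕ} {Sbt S0 etain etaout : ℝ} {b c s : Fin T → ℝ}
    (hS0 : S0 ≤ Sbt) (hin : 0 < etain) (hin1 : etain ≤ 1)
    (hout : 0 < etaout) (hout1 : etaout ≤ 1) (hb : ∀ t, 0 ≤ b t) (hc : ∀ t, 0 ≤ c t)
    (hs : ∀ t, s t = sprev T S0 s t + etain * c t - (1 / etaout) * b t)
    (hsS : ∀ t, s t ≤ Sbt) (n : ℕ) (hn : n < T) :
    sprev T S0 s ⟨n, hn⟩ ≤ nettedStorage T Sbt S0 etain etaout b c n ∧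
      nettedStorage T Sbt S0 etain etaout b c n ≤ Sbt := by
  induction n with
  | zero => simpa [sprev, nettedStorage] using hS0
  | succ n ih =>
    have hn' : n < T := Nat.lt_of_succ_lt hn
    obtain ⟨h1, h2⟩ := ih hn'
    have hprev : sprev T S0 s ⟨n + 1, hn⟩ = s ⟨n, hn'⟩ := by simp [sprev]
    rw [hprev, nettedStorage_succ T Sbt S0 etain etaout b c ⟨n, hn'⟩]
    refine ⟨?_, nettedStep_le hin hout⟩
    rw [hs]
    exact le_nettedStep hin hin1 hout hout1 (hb _) (hc _) h1 h2 (hs ⟨n, hn'⟩ ▸ hsS _)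

/-- every 2BB-1F feasible point is dominated by a 1BB-1F feasible point. -/
theorem stmt5 (T : ℕ) (hT : 1 ≤ T) (Pbt Sbt S0 etain etaout : ℝ)
    (hPbt : 0 ≤ Pbt) (hSbt : 0 ≤ Sbt) (hS0 : 0 ≤ S0) (hS0' : S0 ≤ Sbt)
    (hin : 0 < etain) (hin1 : etain ≤ 1) (hout : 0 < etaout) (hout1 : etaout ≤ 1)
    (Ppv D : Fin T → ℝ) (hPpv : ∀ t, 0 ≤ Ppv t) (hD : ∀ t, 0 ≤ D t)
    (fbtcp fpvcp fcpbt fcped s : Fin T → ℝ)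
    (hfeas : Feas2BB1F T Pbt Sbt S0 etain etaout Ppv D fbtcp fpvcp fcpbt fcped s) :
    ∃ fbted' fpvbt' fpved' s' : Fin T → ℝ,
      Feas1BB T Pbt Sbt S0 etain etaout Ppv D fbted' fpvbt' fpved' s' ∧
      (∀ t : Fin T, fpvbt' t + fpved' t ≤ fpvcp t ∧ fbted' t ≤ fbtcp t) ∧
      ∀ Cpv Cbt : ℝ, 0 ≤ Cpv → 0 ≤ Cbt →
        ∑ t, (Cpv * (fpvbt' t + fpved' t) + Cbt * fbted' t)
          ≤ ∑ t, (Cpv * fpvcp t + Cbt * fbtcp t) := by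
  set u := nettedStorage T Sbt S0 etain etaout fbtcp fcpbt with hu
  have hinv : ∀ t : Fin T, sprev T S0 s t ≤ u t ∧ u t ≤ Sbt := fun t =>
    sprev_le_nettedStorage hS0' hin hin1 hout hout1 (fun t => (hfeas t).1)
      (fun t => (hfeas t).2.2.1) (fun t => (hfeas t).2.2.2.2.2.2.2.1)
      (fun t => (hfeas t).2.2.2.2.2.2.2.2.2.2.2.2) t t.isLt
  have hdom : ∀ t : Fin T,
      min (max (fcpbt t - fbtcp t) 0) ((Sbt - u t) / etain)
          + (D t - max (fbtcp t - fcpbt t) 0) ≤ fpvcp t ∧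
        max (fbtcp t - fcpbt t) 0 ≤ fbtcp t := by
    intro t
    obtain ⟨hb, -, hc, -, -, hbal, hdem, -⟩ := hfeas t
    refine ⟨?_, max_le (by linarith) hb⟩
    have hmin := min_le_left (max (fcpbt t - fbtcp t) 0) ((Sbt - u t) / etain)
    have hmax := max_zero_sub_max_neg_zero_eq_self (fcpbt t - fbtcp t)
    rw [neg_sub] at hmax
    linarith
  refine ⟨fun t => max (fbtcp t - fcpbt t) 0,
    fun t => min (max (fcpbt t - fbtcp t) 0) ((Sbt - u t) / etain),
    fun t => D t - max (fbtcp t - fcpbt t) 0, fun t => u (t + 1), ?_, hdom, ?_⟩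
  · intro t
    obtain ⟨hb, hp, hc, -, hs0, hbal, hdem, hs, hbP, hcP, hpP, -, hsS⟩ := hfeas t
    obtain ⟨h1, h2⟩ := hinv t
    have hsucc := nettedStorage_succ T Sbt S0 etain etaout fbtcp fcpbt t
    rw [← hu] at hsucc
    have hle : s t ≤ u (t + 1) := by
      rw [hsucc, hs]
      exact le_nettedStep hin hin1 hout hout1 hb hc h1 h2 (hs ▸ hsS)
    refine ⟨le_max_right _ _,
      le_min (le_max_right _ _) (div_nonneg (sub_nonneg.2 h2) hin.le),
      sub_nonneg.2 (max_le (by linarith) (hD t)), hs0.trans hle, by ring, ?_,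
      (hdom t).2.trans hbP,
      (min_le_left _ _).trans (max_le (by linarith) hPbt),
      (hdom t).1.trans hpP, ?_⟩
    · have hprev : sprev T S0 (fun i => u (i + 1)) t = u t := sprev_comp_succ T u t
      rw [hprev]
      exact hsucc
    · change u (t + 1) ≤ Sbt
      rw [hsucc]
      exact nettedStep_le hin hout
  · intro Cpv Cbt hCpv hCbt
    exact Finset.sum_le_sum fun t _ => add_le_add
      (mul_le_mul_of_nonneg_left (hdom t).1 hCpv) (mul_le_mul_of_nonneg_left (hdom t).2 hCbt)
end

section
/- In the 2BB-2F model with the reverse connection capacity set to zero, the battery cannot gain more energy than the PV can supply: assuming ηin·ηout ≤ 1, for every 2BB-2F feasible point and every t ∈ {1,…,T}, the storage increment satisfies s(t) − s(t−1) ≤ ηin·P_pv(t) (with s(0) := S0), even though the model allows simultaneous charging and discharging of the battery. -/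
open Finset

/-- in the 2BB-2F model (reverse connection capacity zero), assuming
`etain * etaout ≤ 1`, the storage increment is bounded by `etain * Ppv t`. -/
theorem stmt9 (T : ℕ) (hT : 1 ≤ T) (Pbt Sbt S0 etain etaout : ℝ)
    (hPbt : 0 ≤ Pbt) (hSbt : 0 ≤ Sbt) (hS0 : 0 ≤ S0) (hS0' : S0 ≤ Sbt)
    (hin : 0 < etain) (hin1 : etain ≤ 1) (hout : 0 < etaout) (hout1 : etaout ≤ 1)
    (Ppv D : Fin T → ℝ) (hPpv : ∀ t, 0 ≤ Ppv t) (hD : ∀ t, 0 ≤ D t)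
    (heff : etain * etaout ≤ 1)
    (fbtcp fpvcp fcpbt fcped fedcp s : Fin T → ℝ)
    (hfeas : Feas2BB2F T Pbt Sbt S0 etain etaout Ppv D fbtcp fpvcp fcpbt fcped fedcp s) :
    ∀ t : Fin T, s t - sprev T S0 s t ≤ etain * Ppv t := by
  intro t
  obtain ⟨hbt, -, -, hcped, -, -, hbal, -, hstore, -, -, hpv, hed, -, -⟩ := hfeas t
  have hcharge : fcpbt t ≤ fbtcp t + Ppv t := by linarith
  have hloss : etain ≤ 1 / etaout := (le_div_iff₀ hout).2 heff
  have hgain : etain * fcpbt t ≤ etain * (fbtcp t + Ppv t) :=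
    mul_le_mul_of_nonneg_left hcharge hin.le
  have hdischarge : etain * fbtcp t ≤ 1 / etaout * fbtcp t :=
    mul_le_mul_of_nonneg_right hloss hbt
  linarith
end
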